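/- Fix d∈ℕ+. There exist 7-layer transformer parameters Θ* with token dimension 4d+8 and at most 8 attention heads per layer such that: for every B≥1, L∈ℕ+, r⃗=(r_1,…,r_L)∈(ℕ∪{0})^L, U⊆B_d(B), every g∈G(r⃗,d,U,B), and every S ≥ max(d·r̄·B^{4L}, 2L) where r̄ = max_ℓ r_ℓ, there exists a prompt H^P∈P_U(T,L,S) with T = 2Σ_{ℓ∈[L]} r_ℓ such that for every N∈ℕ+ and z_1,…,z_N∈[0,1]^d, the tokens sequentially generated by TF_{Θ*} from the initial input [H^P, h^D(z_1,T+1,S),…,h^D(z_N,T+N,S)] satisfy, for all i∈[N] and ℓ∈[L], h_{T+Nℓ+i} = ((W_ℓ σ(W_{ℓ−1} σ(⋯σ(W_1 z_i)⋯)))ᵀ, p(−ℓ, T+Nℓ+i, S)ᵀ)ᵀ, where W_1,…,W_L are the weight matrices of g; in particular the first d coordinates of token T+NL+i equal g(z_i) for all i∈[N]. -/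

import Mathlib

open scoped BigOperators
open Matrix

noncomputable section

namespace PromptTF

/-- The ReLU activation function. -/
def relu (x : ℝ) : ℝ := max x 0

/-- The elementary universal activation function (EUAF). -/
def euaf (x : ℝ) : ℝ :=
  if 0 ≤ x then |x - 2 * (⌊(x + 1) / 2⌋ : ℝ)| else x / (1 + |x|)

/-- Parameters of one transformer layer (attention heads and a feed-forward net). -/
structure TFLayer (D : ℕ) where
  M : ℕ
  Q : Fin M → Matrix (Fin D) (Fin D) ℝ
  K : Fin M → Matrix (Fin D) (Fin D) ℝ
  V : Fin M → Matrix (Fin D) (Fin D) ℝ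
  width : ℕ
  W1 : Matrix (Fin width) (Fin D) ℝ
  W2 : Matrix (Fin D) (Fin width) ℝ

/-- Self-attention layer applied to a list of tokens. -/
def attnOut {D : ℕ} (θ : TFLayer D) (H : List (Fin D → ℝ)) : List (Fin D → ℝ) :=
  H.map fun h => fun i =>
    h i + ∑ m : Fin θ.M,
      (H.map fun h' =>
        relu (dotProduct ((θ.Q m).mulVec h) ((θ.K m).mulVec h')) * ((θ.V m).mulVec h') i).sum

/-- One transformer layer `FFN ∘ Attn`, with feed-forward activation `act`. -/
def layerMap {D : ℕ} (act : ℝ → ℝ) (θ : TFLayer D) (H : List (Fin D → ℝ)) :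
    List (Fin D → ℝ) :=
  (attnOut θ H).map fun h => fun i =>
    h i + (θ.W2.mulVec fun k => act ((θ.W1.mulVec h) k)) i

/-- Multi-layer transformer, all activations ReLU. -/
def tfForward {D : ℕ} (Θ : List (TFLayer D)) (H : List (Fin D → ℝ)) : List (Fin D → ℝ) :=
  Θ.foldl (fun H' θ => layerMap relu θ H') H

/-- Multi-layer transformer whose first feed-forward layer uses the EUAF activation. -/
def tfForwardEUAF {D : ℕ} (Θ : List (TFLayer D)) (H : List (Fin D → ℝ)) :
    List (Fin D → ℝ) :=
  match Θ with
  | [] => H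
  | θ :: rest => rest.foldl (fun H' θ' => layerMap relu θ' H') (layerMap euaf θ H)

/-- Sequential (autoregressive) generation: append the last output column repeatedly. -/
def genTokens {D : ℕ} (forward : List (Fin D → ℝ) → List (Fin D → ℝ))
    (H : List (Fin D → ℝ)) : ℕ → List (Fin D → ℝ)
  | 0 => H
  | v + 1 =>
      genTokens forward H v ++ [(forward (genTokens forward H v)).getLastD (fun _ => 0)]

/-- The token at one-based position `m` in the generated sequence. -/
def tokenAt {D : ℕ} (forward : List (Fin D → ℝ) → List (Fin D → ℝ))
    (H : List (Fin D → ℝ)) (m : ℕ) : Fin D → ℝ :=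
  (genTokens forward H (m - H.length)).getD (m - 1) (fun _ => 0)

/-- A token with word embedding `u`, layer index `w`, position `j` and scale `S`:
`(uᵀ, 0_{3d+4}ᵀ, 1, S, S·w, S·j)ᵀ ∈ ℝ^{4d+8}`. -/
def promptToken (d : ℕ) (u : Fin d → ℝ) (w : ℤ) (j : ℕ) (S : ℝ) : Fin (4 * d + 8) → ℝ :=
  fun i =>
    if h : (i : ℕ) < d then u ⟨i, h⟩
    else if (i : ℕ) = 4 * d + 4 then 1
    else if (i : ℕ) = 4 * d + 5 then S
    else if (i : ℕ) = 4 * d + 6 then S * w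
    else if (i : ℕ) = 4 * d + 7 then S * j
    else 0

/-- First `d` coordinates of a token. -/
def firstd (d : ℕ) (h : Fin (4 * d + 8) → ℝ) : Fin d → ℝ :=
  fun k => h (Fin.castLE (by omega) k)

/-- Initial input: `T` prompt tokens followed by `N` data tokens. -/
def initialInput (d T N : ℕ) (u : Fin T → Fin d → ℝ) (w : Fin T → ℕ) (S : ℝ)
    (z : Fin N → Fin d → ℝ) : List (Fin (4 * d + 8) → ℝ) :=
  ((List.finRange T).map fun j => promptToken d (u j) (w j) ((j : ℕ) + 1) S)
    ++ ((List.finRange N).map fun i => promptToken d (z i) 0 (T + (i : ℕ) + 1) S)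

/-- The closed Euclidean ball of radius `B` in `ℝ^d`. -/
def eball (d : ℕ) (B : ℝ) : Set (Fin d → ℝ) :=
  {v | Real.sqrt (∑ k, v k ^ 2) ≤ B}

/-- Data of a valid prompt in `P_U(T, L, S)`: word embeddings in `U`,
layer indices in `{1, …, 2L}`. -/
def ValidPrompt {d : ℕ} (U : Set (Fin d → ℝ)) (T L : ℕ)
    (u : Fin T → Fin d → ℝ) (w : Fin T → ℕ) : Prop :=
  (∀ j, u j ∈ U) ∧ ∀ j, 1 ≤ w j ∧ w j ≤ 2 * L

/-- The virtual weight matrix `W^P_ℓ` (without the first-layer correction term). -/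
def WPmat {d T : ℕ} (u : Fin T → Fin d → ℝ) (w : Fin T → ℕ) (ℓ : ℕ) :
    Matrix (Fin d) (Fin d) ℝ :=
  ∑ j : Fin T,
    if h : (j : ℕ) + 1 < T then
      (if w j = 2 * ℓ - 1 ∧ w ⟨(j : ℕ) + 1, h⟩ = 2 * ℓ then
        vecMulVec (u j) (u ⟨(j : ℕ) + 1, h⟩) else 0)
    else 0

/-- The first-layer correction term `(h_T)_{1:d} 1{w_T=1} Σ_{j'} (h_{j'})_{1:d}ᵀ 1{w_{j'}=1}`. -/
def WPcorr {d T : ℕ} (u : Fin T → Fin d → ℝ) (w : Fin T → ℕ) :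
    Matrix (Fin d) (Fin d) ℝ :=
  if hT : 0 < T then
    (if w ⟨T - 1, by omega⟩ = 1 then
      vecMulVec (u ⟨T - 1, by omega⟩) (∑ j : Fin T, if w j = 1 then u j else 0)
    else 0)
  else 0

/-- The virtual first-layer weight matrix `W^P_{1,i}`; `first` indicates `i = 1`. -/
def WPone {d T : ℕ} (u : Fin T → Fin d → ℝ) (w : Fin T → ℕ) (first : Bool) :
    Matrix (Fin d) (Fin d) ℝ :=
  WPmat u w 1 + if first then WPcorr u w else 0

/-- The family of virtual weight matrices of a prompt, for the data token with
zero-based index `i`. -/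
def WPfam {d T : ℕ} (u : Fin T → Fin d → ℝ) (w : Fin T → ℕ) (i : ℕ) :
    ℕ → Matrix (Fin d) (Fin d) ℝ :=
  fun ℓ => if ℓ = 1 then WPone u w (i == 0) else WPmat u w ℓ

/-- Output of the virtual network after `ℓ` layers:
`vnetOut … ℓ = W_ℓ act(W_{ℓ-1} act( ⋯ act(W_1 z) ⋯ ))`. -/
def vnetOut (d : ℕ) (act : ℝ → ℝ) (Ws : ℕ → Matrix (Fin d) (Fin d) ℝ)
    (z : Fin d → ℝ) : ℕ → Fin d → ℝ
  | 0 => z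
  | ℓ + 1 =>
      (Ws (ℓ + 1)).mulVec fun k =>
        if ℓ = 0 then vnetOut d act Ws z ℓ k else act (vnetOut d act Ws z ℓ k)

/-- The emulation property: for every admissible prompt and data tokens, the sequentially
generated tokens realize the virtual neural network encoded by the prompt
(with activation `act`). -/
def EmulatesWith (d : ℕ)
    (forward : List (Fin (4 * d + 8) → ℝ) → List (Fin (4 * d + 8) → ℝ))
    (act : ℝ → ℝ) : Prop :=
  ∀ B : ℝ, 1 ≤ B → ∀ T L : ℕ, 0 < T → 0 < L →
  ∀ U : Set (Fin d → ℝ), U ⊆ eball d B →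
  ∀ S : ℝ, max ((d : ℝ) * B ^ (4 * L) * (T : ℝ) ^ (2 * L)) (2 * (L : ℝ)) ≤ S →
  ∀ (u : Fin T → Fin d → ℝ) (w : Fin T → ℕ), ValidPrompt U T L u w →
  ∀ N : ℕ, 0 < N → ∀ z : Fin N → Fin d → ℝ, (∀ i k, z i k ∈ Set.Icc (0 : ℝ) 1) →
  ∀ (i : Fin N) (ℓ : ℕ), 1 ≤ ℓ → ℓ ≤ L →
    tokenAt forward (initialInput d T N u w S z) (T + N * ℓ + (i : ℕ) + 1)
      = promptToken d (vnetOut d act (WPfam u w (i : ℕ)) (z i) ℓ) (-(ℓ : ℤ))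
          (T + N * ℓ + (i : ℕ) + 1) S

/-- The embedding `x ↦ (xᵀ, 1, 0_{d-p-1}ᵀ)ᵀ ∈ ℝ^d` of an input `x ∈ ℝ^p`. -/
def embed (d p : ℕ) (x : Fin p → ℝ) : Fin d → ℝ :=
  fun k => if h : (k : ℕ) < p then x ⟨k, h⟩ else if (k : ℕ) = p then 1 else 0

/-- The function approximator `f̂_{Θ,H^P,L,p}`: first coordinate of the token at
position `T+1+L` generated from the prompt followed by the single data token. -/
def fhat {d : ℕ} (forward : List (Fin (4 * d + 8) → ℝ) → List (Fin (4 * d + 8) → ℝ))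
    {T : ℕ} (u : Fin T → Fin d → ℝ) (w : Fin T → ℕ) (S : ℝ) (L p : ℕ)
    (x : Fin p → ℝ) : ℝ :=
  tokenAt forward (initialInput d T 1 u w S fun _ => embed d p x) (T + 1 + L)
    ⟨0, by omega⟩

/-- The unit cube `[0,1]^p`. -/
def unitCube (p : ℕ) : Set (Fin p → ℝ) := Set.Icc 0 1

/-- The sup-distance `‖f - g‖_{L^∞([0,1]^p)}`. -/
def supDist (p : ℕ) (f g : (Fin p → ℝ) → ℝ) : ℝ :=
  ⨆ x : unitCube p, |f x.1 - g x.1|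

/-- Partial derivative (within the unit cube) in coordinate direction `i`. -/
def pderivW (p : ℕ) (i : Fin p) (f : (Fin p → ℝ) → ℝ) : (Fin p → ℝ) → ℝ :=
  fun x => fderivWithin ℝ f (unitCube p) x (Pi.single i 1)

/-- Iterated partial derivative along a list of coordinate directions. -/
def pderivList (p : ℕ) : List (Fin p) → ((Fin p → ℝ) → ℝ) → (Fin p → ℝ) → ℝ
  | [], f => f
  | i :: is, f => pderivList p is (pderivW p i f)

/-- The unit ball `C_u^β([0,1]^p)` of `β`-times continuously differentiable functions with
all partial derivatives of order `≤ β` bounded by `1` on the cube. -/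
def Hclass (p β : ℕ) : Set ((Fin p → ℝ) → ℝ) :=
  {f | ContDiffOn ℝ β f (unitCube p) ∧
    ∀ ls : List (Fin p), ls.length ≤ β →
      ∀ x ∈ unitCube p, |pderivList p ls f x| ≤ 1}

/-- `U_{d,r}` : the span of the first `r` standard basis vectors of `ℝ^d`. -/
def spanFirst (d r : ℕ) : Set (Fin d → ℝ) :=
  {v | ∀ k : Fin d, r ≤ (k : ℕ) → v k = 0}

/-- Hidden layers of a standard ReLU network of width `r` (with biases). -/
def nnHidden {p r : ℕ} (W0 : Matrix (Fin r) (Fin p) ℝ) (b0 : Fin r → ℝ)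
    (Wm : ℕ → Matrix (Fin r) (Fin r) ℝ) (bm : ℕ → Fin r → ℝ) (x : Fin p → ℝ) :
    ℕ → Fin r → ℝ
  | 0 => fun i => W0.mulVec x i + b0 i
  | k + 1 => fun i =>
      (Wm k).mulVec (fun j => relu (nnHidden W0 b0 Wm bm x k j)) i + bm k i

/-- The class `N(r,p,L)` of ReLU networks `ℝ^p → ℝ` of width `r` and depth `L`
(`L` affine maps with ReLU in between). -/
def NNclass (r p L : ℕ) : Set ((Fin p → ℝ) → ℝ) :=
  {f | if L = 1 then ∃ (a : Fin p → ℝ) (b : ℝ), f = fun x => (∑ i, a i * x i) + b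
    else ∃ (W0 : Matrix (Fin r) (Fin p) ℝ) (b0 : Fin r → ℝ)
      (Wm : ℕ → Matrix (Fin r) (Fin r) ℝ) (bm : ℕ → Fin r → ℝ)
      (wL : Fin r → ℝ) (bL : ℝ),
      f = fun x => (∑ j, wL j * relu (nnHidden W0 b0 Wm bm x (L - 2) j)) + bL}

/-- Operator norm (w.r.t. the Euclidean norm) of a `d × d` matrix. -/
def opNorm {d : ℕ} (W : Matrix (Fin d) (Fin d) ℝ) : ℝ :=
  ‖LinearMap.toContinuousLinearMap (Matrix.toEuclideanLin W)‖

/-- The class `W(r,d,U,B)` of coarse weight matrices. -/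
def coarseW (d r : ℕ) (U : Set (Fin d → ℝ)) (B : ℝ) :
    Set (Matrix (Fin d) (Fin d) ℝ) :=
  {W | (∃ ut uu : Fin r → Fin d → ℝ,
        (∀ k, ut k ∈ U) ∧ (∀ k, uu k ∈ U) ∧ W = ∑ k, vecMulVec (ut k) (uu k)) ∧
    opNorm W ≤ B ^ 2}

open Classical in
/-- Number of nonzero parameter entries of one transformer layer. -/
def layerNonzero {D : ℕ} (θ : TFLayer D) : ℕ :=
  (Finset.univ.filter fun p : Fin θ.M × Fin D × Fin D => θ.Q p.1 p.2.1 p.2.2 ≠ 0).card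
  + (Finset.univ.filter fun p : Fin θ.M × Fin D × Fin D => θ.K p.1 p.2.1 p.2.2 ≠ 0).card
  + (Finset.univ.filter fun p : Fin θ.M × Fin D × Fin D => θ.V p.1 p.2.1 p.2.2 ≠ 0).card
  + (Finset.univ.filter fun p : Fin θ.width × Fin D => θ.W1 p.1 p.2 ≠ 0).card
  + (Finset.univ.filter fun p : Fin D × Fin θ.width => θ.W2 p.1 p.2 ≠ 0).card

/-- Total number of nonzero parameter entries of a transformer. -/
def tfNonzero {D : ℕ} (Θ : List (TFLayer D)) : ℕ := (Θ.map layerNonzero).sum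

/-- All parameter entries of one layer bounded in absolute value by `c`. -/
def layerEntriesBounded {D : ℕ} (θ : TFLayer D) (c : ℝ) : Prop :=
  (∀ m i j, |θ.Q m i j| ≤ c) ∧ (∀ m i j, |θ.K m i j| ≤ c) ∧ (∀ m i j, |θ.V m i j| ≤ c)
  ∧ (∀ i j, |θ.W1 i j| ≤ c) ∧ ∀ i j, |θ.W2 i j| ≤ c

end PromptTF
end

open PromptTF Matrix

namespace PromptTF

/-- Functions computed by the residual branch of a ReLU feed-forward layer. -/
def IsFFN {E : Type} [AddCommGroup E] [Module ℝ E] (f : E → E) : Prop :=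
  ∃ (κ : Type) (_ : Fintype κ) (a : κ → E →ₗ[ℝ] ℝ) (b : κ → E),
    ∀ h, f h = ∑ i, relu (a i h) • b i

theorem relu_sub_relu_neg (x : ℝ) : relu x - relu (-x) = x := by
  simp only [relu]
  rcases le_total x 0 with h | h <;> simp [h]

section FFN

variable {E : Type} [AddCommGroup E] [Module ℝ E]

theorem IsFFN.add {f g : E → E} (hf : IsFFN f) (hg : IsFFN g) : IsFFN fun h => f h + g h := by
  obtain ⟨κ, _, a, b, hf⟩ := hf
  obtain ⟨κ', _, a', b', hg⟩ := hg
  exact ⟨κ ⊕ κ', inferInstance, Sum.elim a a', Sum.elim b b', fun h => by simp [hf, hg]⟩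

theorem IsFFN.zero : IsFFN fun _ : E => (0 : E) :=
  ⟨Empty, inferInstance, Empty.elim, Empty.elim, by simp⟩

theorem IsFFN.relu_smul (a : E →ₗ[ℝ] ℝ) (b : E) : IsFFN fun h => relu (a h) • b :=
  ⟨Unit, inferInstance, fun _ => a, fun _ => b, by simp⟩

theorem IsFFN.sum {κ : Type} [Fintype κ] {f : κ → E → E} (hf : ∀ i, IsFFN (f i)) :
    IsFFN fun h => ∑ i, f i h := by
  choose κ' _ a b hf using hf
  exact ⟨Σ i, κ' i, inferInstance, fun p => a p.1 p.2, fun p => b p.1 p.2, fun h => by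
    simp [hf, Fintype.sum_sigma]⟩

theorem IsFFN.linear [FiniteDimensional ℝ E] (f : E →ₗ[ℝ] E) : IsFFN f := by
  let B := Module.finBasis ℝ E
  have key : IsFFN fun h => ∑ i, (relu (B.coord i h) • f (B i) + relu ((-B.coord i) h) • -f (B i)) :=
    IsFFN.sum fun i => (IsFFN.relu_smul _ _).add (IsFFN.relu_smul _ _)
  convert key using 2 with h
  conv_lhs => rw [← B.sum_repr h, map_sum]
  refine Finset.sum_congr rfl fun i _ => ?_
  rw [map_smul, smul_neg, ← sub_eq_add_neg, ← sub_smul, LinearMap.neg_apply, relu_sub_relu_neg,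
    Module.Basis.coord_apply]

end FFN

theorem sum_map_range {A : Type} [AddCommMonoid A] (n : ℕ) (f : ℕ → A) :
    ((List.range n).map f).sum = ∑ i ∈ Finset.range n, f i := rfl

/-- Every family of bilinear scores and linear values, together with a feed-forward branch,
is realized by a transformer layer. -/
theorem exists_layer {D : ℕ} {E : Type} [AddCommGroup E] [Module ℝ E]
    (φ : E ≃ₗ[ℝ] (Fin D → ℝ)) (M : ℕ) (β : Fin M → E →ₗ[ℝ] E →ₗ[ℝ] ℝ) (v : Fin M → E →ₗ[ℝ] E)
    {f : E → E} (hf : IsFFN f) :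
    ∃ θ : TFLayer D, θ.M = M ∧ ∀ (n : ℕ) (t g t' : ℕ → E),
      (∀ j < n, g j = t j + ∑ m, ∑ i ∈ Finset.range n, relu (β m (t j) (t i)) • v m (t i)) →
      (∀ j < n, t' j = g j + f (g j)) →
      layerMap relu θ ((List.range n).map fun j => φ (t j))
        = (List.range n).map fun j => φ (t' j) := by
  obtain ⟨κ, _, a, b, hf⟩ := hf
  let e := Fintype.equivFin κ
  refine ⟨⟨M, fun _ => 1,
    fun m => LinearMap.toMatrix₂' ℝ ((β m).compl₁₂ φ.symm.toLinearMap φ.symm.toLinearMap),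
    fun m => LinearMap.toMatrix' (φ.toLinearMap ∘ₗ v m ∘ₗ φ.symm.toLinearMap), Fintype.card κ,
    LinearMap.toMatrix' (LinearMap.pi fun i => a (e.symm i) ∘ₗ φ.symm.toLinearMap),
    Matrix.of fun i k => φ (b (e.symm k)) i⟩, rfl, ?_⟩
  intro n t g t' hg ht'
  have hscore : ∀ m (x y : E), Matrix.mulVec (1 : Matrix (Fin D) (Fin D) ℝ) (φ x) ⬝ᵥ
      Matrix.mulVec (LinearMap.toMatrix₂' ℝ
        ((β m).compl₁₂ φ.symm.toLinearMap φ.symm.toLinearMap)) (φ y) = β m x y := by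
    intro m x y
    rw [Matrix.one_mulVec, ← Matrix.toLinearMap₂'_apply', Matrix.toLinearMap₂'_toMatrix']
    simp
  have hval : ∀ m (y : E), Matrix.mulVec (LinearMap.toMatrix'
      (φ.toLinearMap ∘ₗ v m ∘ₗ φ.symm.toLinearMap)) (φ y) = φ (v m y) := by
    intro m y
    rw [LinearMap.toMatrix'_mulVec]
    simp
  have hw : ∀ y : E, Matrix.mulVec (LinearMap.toMatrix'
      (LinearMap.pi fun i => a (e.symm i) ∘ₗ φ.symm.toLinearMap)) (φ y)
        = fun i => a (e.symm i) y := by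
    intro y
    rw [LinearMap.toMatrix'_mulVec]
    ext i
    simp
  simp only [layerMap, attnOut, List.map_map, Function.comp_def]
  refine List.map_congr_left fun j hj => ?_
  rw [List.mem_range] at hj
  simp only [hscore, hval, sum_map_range]
  have h1 : (fun i => φ (t j) i + ∑ m, ∑ i' ∈ Finset.range n,
      relu (β m (t j) (t i')) * φ (v m (t i')) i) = φ (g j) := by
    rw [hg j hj]
    ext i
    simp [Finset.sum_apply]
  rw [h1, hw, ht' j hj, hf]
  ext i
  simp only [map_add, map_sum, map_smul, Pi.add_apply, Finset.sum_apply, Pi.smul_apply,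
    smul_eq_mul, Matrix.mulVec, dotProduct, Matrix.of_apply]
  congr 1
  · exact congrFun h1 i
  · rw [← Equiv.sum_comp e]
    simp [mul_comm]

/-- Tokens organized as four blocks in `ℝ^d` followed by eight scalars. -/
abbrev Tok (d : ℕ) : Type := (Fin 4 → Fin d → ℝ) × (Fin 8 → ℝ)

/-- The coordinates of a token, as blocks and scalars. -/
def tokIndex (d : ℕ) : Fin 4 × Fin d ⊕ Fin 8 ≃ Fin (4 * d + 8) :=
  (Equiv.sumCongr finProdFinEquiv (Equiv.refl _)).trans finSumFinEquiv

/-- Concatenation of the blocks and scalars of a token into one vector. -/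
def tokEquiv (d : ℕ) : Tok d ≃ₗ[ℝ] (Fin (4 * d + 8) → ℝ) :=
  ((LinearEquiv.funCongrLeft ℝ ℝ (tokIndex d)).trans
    ((LinearEquiv.sumArrowLequivProdArrow _ _ ℝ ℝ).trans
      (LinearEquiv.prodCongr (LinearEquiv.curry ℝ ℝ (Fin 4) (Fin d))
        (LinearEquiv.refl ℝ (Fin 8 → ℝ))))).symm

theorem tokEquiv_inl {d : ℕ} (x : Tok d) (b : Fin 4) (k : Fin d) :
    tokEquiv d x (tokIndex d (Sum.inl (b, k))) = x.1 b k := by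
  obtain ⟨y, rfl⟩ := (tokEquiv d).symm.surjective x
  rw [LinearEquiv.apply_symm_apply]
  rfl

theorem tokEquiv_inr {d : ℕ} (x : Tok d) (s : Fin 8) :
    tokEquiv d x (tokIndex d (Sum.inr s)) = x.2 s := by
  obtain ⟨y, rfl⟩ := (tokEquiv d).symm.surjective x
  rw [LinearEquiv.apply_symm_apply]
  rfl

theorem promptToken_eq_tokEquiv (d : ℕ) (u : Fin d → ℝ) (w : ℤ) (j : ℕ) (S : ℝ) :
    promptToken d u w j S = tokEquiv d (![u, 0, 0, 0], ![0, 0, 0, 0, 1, S, S * w, S * j]) := by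
  ext i
  obtain ⟨x | s, rfl⟩ := (tokIndex d).surjective i
  · obtain ⟨b, k⟩ := x
    rw [tokEquiv_inl]
    have hv : ((tokIndex d (Sum.inl (b, k))) : ℕ) = k + d * b := by simp [tokIndex]
    have hlt : (k : ℕ) + d * b < 4 * d := by nlinarith [k.2, b.2]
    simp only [promptToken, hv, show ¬ (k : ℕ) + d * b = 4 * d + 4 by omega,
      show ¬ (k : ℕ) + d * b = 4 * d + 5 by omega, show ¬ (k : ℕ) + d * b = 4 * d + 6 by omega,
      show ¬ (k : ℕ) + d * b = 4 * d + 7 by omega, if_false]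
    by_cases hb : b = 0
    · subst hb
      simp
    · have hb1 : 1 ≤ (b : ℕ) := by
        have := Fin.val_ne_zero_iff.2 hb
        omega
      rw [dif_neg (by nlinarith)]
      fin_cases b <;> simp_all
  · rw [tokEquiv_inr]
    have hv : ((tokIndex d (Sum.inr s)) : ℕ) = 4 * d + s := by simp [tokIndex]
    have hlt : ¬ (4 * d + (s : ℕ) < d) := by omega
    simp only [promptToken, hv, hlt, dif_neg, not_false_eq_true, Nat.add_left_cancel_iff]
    fin_cases s <;> simp

/-- The `s`-th scalar of a token. -/
def sc {d : ℕ} (s : Fin 8) : Tok d →ₗ[ℝ] ℝ := LinearMap.proj s ∘ₗ LinearMap.snd ℝ _ _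

/-- The `b`-th block of a token. -/
def blk {d : ℕ} (b : Fin 4) : Tok d →ₗ[ℝ] (Fin d → ℝ) := LinearMap.proj b ∘ₗ LinearMap.fst ℝ _ _

/-- The token whose only nonzero scalar is the `s`-th one. -/
def scIn {d : ℕ} (s : Fin 8) : ℝ →ₗ[ℝ] Tok d :=
  LinearMap.inr ℝ _ _ ∘ₗ LinearMap.single ℝ (fun _ : Fin 8 => ℝ) s

/-- The token whose only nonzero block is the `b`-th one. -/
def blkIn {d : ℕ} (b : Fin 4) : (Fin d → ℝ) →ₗ[ℝ] Tok d :=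
  LinearMap.inl ℝ _ _ ∘ₗ LinearMap.single ℝ (fun _ : Fin 4 => Fin d → ℝ) b

@[simp] theorem sc_apply {d : ℕ} (s : Fin 8) (h : Tok d) : sc s h = h.2 s := rfl

@[simp] theorem blk_apply {d : ℕ} (b : Fin 4) (h : Tok d) : blk b h = h.1 b := rfl

@[simp] theorem scIn_fst {d : ℕ} (s : Fin 8) (x : ℝ) : (scIn (d := d) s x).1 = 0 := rfl

@[simp] theorem blkIn_snd {d : ℕ} (b : Fin 4) (x : Fin d → ℝ) : (blkIn b x).2 = 0 := rfl

@[simp] theorem scIn_snd {d : ℕ} (s : Fin 8) (x : ℝ) :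
    (scIn (d := d) s x).2 = Pi.single s x := rfl

@[simp] theorem blkIn_fst {d : ℕ} (b : Fin 4) (x : Fin d → ℝ) :
    (blkIn b x).1 = Pi.single b x := rfl

/-- The product of two linear functionals, as a bilinear form. -/
def prodForm {d : ℕ} (a b : Tok d →ₗ[ℝ] ℝ) : Tok d →ₗ[ℝ] Tok d →ₗ[ℝ] ℝ :=
  (LinearMap.mul ℝ ℝ).compl₁₂ a b

@[simp] theorem prodForm_apply {d : ℕ} (a b : Tok d →ₗ[ℝ] ℝ) (h h' : Tok d) :
    prodForm a b h h' = a h * b h' := rfl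

/-- The inner product of two blocks, as a bilinear form. -/
def dotForm {d : ℕ} (a b : Fin 4) : Tok d →ₗ[ℝ] Tok d →ₗ[ℝ] ℝ :=
  (dotProductBilin ℝ ℝ).compl₁₂ (blk a) (blk b)

@[simp] theorem dotForm_apply {d : ℕ} (a b : Fin 4) (h h' : Tok d) :
    dotForm a b h h' = h.1 a ⬝ᵥ h'.1 b := rfl

/-- The piecewise linear hat function of width `c` and height `c`. -/
def hat (c x : ℝ) : ℝ := relu (x + c) - 2 * relu x + relu (x - c)

theorem hat_int_mul {c S : ℝ} (hc : 0 ≤ c) (hS : c ≤ S) (k : ℤ) :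
    hat c (S * k) = if k = 0 then c else 0 := by
  simp only [hat, relu]
  rcases lt_trichotomy k 0 with h | h | h
  · have h1 : (k : ℝ) ≤ -1 := by exact_mod_cast Int.le_sub_one_of_lt h
    have h2 : S * k ≤ -S := by nlinarith
    rw [if_neg h.ne, max_eq_right, max_eq_right, max_eq_right] <;> linarith
  · subst h
    simp [hc]
  · have h1 : (1 : ℝ) ≤ k := by exact_mod_cast h
    have h2 : S ≤ S * k := by nlinarith
    rw [if_neg h.ne', max_eq_left, max_eq_left, max_eq_left] <;> linarith

theorem IsFFN.hat_smul {E : Type} [AddCommGroup E] [Module ℝ E] (c a : E →ₗ[ℝ] ℝ) (b : E) :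
    IsFFN fun h => hat (c h) (a h) • b := by
  convert ((IsFFN.relu_smul (a + c) b).add (IsFFN.relu_smul a ((-2 : ℝ) • b))).add
    (IsFFN.relu_smul (a - c) b) using 2 with h
  simp only [hat, LinearMap.add_apply, LinearMap.sub_apply]
  module

theorem gate {S x : ℝ} (hx : |x| ≤ S) (p : Prop) [Decidable p] :
    relu (x + (if p then S else 0) - S) - relu (-x + (if p then S else 0) - S)
      = if p then x else 0 := by
  obtain ⟨h1, h2⟩ := abs_le.1 hx
  split_ifs with h
  · simp only [add_sub_cancel_right]
    exact relu_sub_relu_neg x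
  · simp only [relu]
    rw [max_eq_right, max_eq_right] <;> linarith

theorem IsFFN.relu_pi {E : Type} [AddCommGroup E] [Module ℝ E] {d : ℕ}
    (a : E →ₗ[ℝ] (Fin d → ℝ)) (b : (Fin d → ℝ) →ₗ[ℝ] E) :
    IsFFN fun h => b fun k => relu (a h k) := by
  convert IsFFN.sum fun k => IsFFN.relu_smul (LinearMap.proj k ∘ₗ a) (b (Pi.single k 1))
    using 2 with h
  simp_rw [← map_smul, ← map_sum]
  congr 1
  ext k
  simp [Finset.sum_apply, Pi.single_apply]

theorem hat_smul_eq {E : Type} [AddCommGroup E] [Module ℝ E] (c x : ℝ) (y : E) :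
    relu (x + c) • y + relu x • ((-2 : ℝ) • y) + relu (x - c) • y = hat c x • y := by
  simp only [hat]
  module

/-- Each token learns the distance from the end of the sequence at which its source lies,
fetches the embedding of its right neighbour, and applies the ReLU to its own embedding. -/
theorem exists_locating_layer (d : ℕ) : ∃ θ : TFLayer (4 * d + 8), θ.M ≤ 8 ∧
    ∀ (n N : ℕ) (S : ℝ) (v : ℕ → Fin d → ℝ) (w : ℕ → ℤ), 1 ≤ S → N ≤ n →
      ((Finset.range n).filter fun i => w i = 0).card = N →
      layerMap relu θ ((List.range n).map fun j => tokEquiv d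
          (![v j, 0, 0, 0], ![0, 0, 0, 0, 1, S, S * w j, S * (j + 1)]))
        = (List.range n).map fun j => tokEquiv d
          (![v j, if j + 1 < n then v (j + 1) else 0, fun k => relu (v j k), 0],
            ![S * (n - N), if j = n - N then 1 else 0, 0, 0, 1, S, S * w j, S * (j + 1)]) := by
  let p : Tok d →ₗ[ℝ] Tok d →ₗ[ℝ] ℝ :=
    prodForm (sc 4) (sc 7) - prodForm (sc 7) (sc 4) - prodForm (sc 4) (sc 5)
  let one : Tok d →ₗ[ℝ] Tok d →ₗ[ℝ] ℝ := prodForm (sc 4) (sc 4)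
  let q : Tok d →ₗ[ℝ] Tok d →ₗ[ℝ] ℝ := prodForm (sc 4) (sc 6)
  let x : Tok d →ₗ[ℝ] Tok d := -(scIn 0 ∘ₗ sc 5)
  let y : Tok d →ₗ[ℝ] Tok d := blkIn 1 ∘ₗ blk 0
  obtain ⟨θ, hM, hθ⟩ := exists_layer (tokEquiv d) 7
    ![one, q + one, q, q - one, p + one, p, p - one]
    ![-x, x, (-2 : ℝ) • x, x, y, (-2 : ℝ) • y, y]
    ((IsFFN.relu_pi (blk 0) (blkIn 2)).add
      (IsFFN.hat_smul (sc 4) (sc 0 + sc 5 - sc 7) (scIn 1 1)))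
  refine ⟨θ, by omega, fun n N S v w hS hN hcard => ?_⟩
  refine hθ n _ (fun j => (![v j, if j + 1 < n then v (j + 1) else 0, 0, 0],
    ![S * (n - N), 0, 0, 0, 1, S, S * w j, S * (j + 1)])) _ (fun j _ => ?_) (fun j _ => ?_)
  · rw [Fin.sum_univ_seven]
    simp only [← Finset.sum_add_distrib]
    have key : ∀ i, hat 1 (S * w i) = if w i = 0 then 1 else 0 := fun i =>
      hat_int_mul zero_le_one hS _
    have key' : ∀ i : ℕ, hat 1 (S * (i + 1) - S * (j + 1) - S) = if i = j + 1 then 1 else 0 := by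
      intro i
      have := hat_int_mul zero_le_one hS (i - j - 1)
      push_cast at this
      rw [show S * (i + 1 : ℝ) - S * (j + 1) - S = S * (i - j - 1) by ring, this]
      congr 1
      rw [eq_iff_iff]
      omega
    rw [Finset.sum_congr rfl (g := fun i => scIn 0 (S - if w i = 0 then S else 0)
      + blkIn 1 (if i = j + 1 then v i else 0))]
    · rw [Finset.sum_add_distrib, ← map_sum, ← map_sum, Finset.sum_sub_distrib,
        ← Finset.sum_filter, Finset.sum_ite_eq']
      simp only [Finset.sum_const, hcard, Finset.card_range, nsmul_eq_mul, Finset.mem_range]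
      ext a b
      · fin_cases a <;> simp
      · fin_cases a <;> simp
        ring
    · intro i _
      have e1 := hat_smul_eq 1 (S * w i) (scIn (d := d) 0 (-S))
      have e2 := hat_smul_eq 1 (S * (i + 1) - S * (j + 1) - S) (blkIn 1 (v i))
      rw [key] at e1
      rw [key'] at e2
      have relu_one : relu 1 = 1 := max_eq_left zero_le_one
      simp [p, q, one, x, y, relu_one, apply_ite (scIn (d := d) 0),
        apply_ite (blkIn (d := d) 1)] at e1 e2 ⊢
      linear_combination (norm := module) e1 + e2
  · have key : hat 1 (S * (n - N) + S - S * (j + 1)) = if j = n - N then 1 else 0 := by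
      have := hat_int_mul zero_le_one hS (n - N - j)
      push_cast at this
      rw [show S * (n - N : ℝ) + S - S * (j + 1) = S * (n - N - j) by ring, this]
      congr 1
      rw [eq_iff_iff]
      omega
    ext a b
    · fin_cases a <;> simp
    · fin_cases a <;> simp
      exact key.symm

/-- Each token fetches the ReLU features and the layer index of its source, and checks whether
its own layer index refers to the next layer to be computed. -/
theorem exists_matching_layer (d : ℕ) : ∃ θ : TFLayer (4 * d + 8), θ.M ≤ 8 ∧
    ∀ (n N : ℕ) (S c : ℝ) (v e f : ℕ → Fin d → ℝ) (w : ℕ → ℤ), 0 ≤ S → 0 < N → N ≤ n →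
      layerMap relu θ ((List.range n).map fun j => tokEquiv d
          (![v j, e j, f j, 0],
            ![c, if j = n - N then 1 else 0, 0, 0, 1, S, S * w j, S * (j + 1)]))
        = (List.range n).map fun j => tokEquiv d
          (![v j, e j, f j, f (n - N)],
            ![c, if j = n - N then 1 else 0, S * w (n - N),
              if w j + 2 * w (n - N) - 1 = 0 then S else 0, 1, S, S * w j, S * (j + 1)]) := by
  obtain ⟨θ, hM, hθ⟩ := exists_layer (tokEquiv d) 1
    ![prodForm (sc 4) (sc 1)] ![blkIn 3 ∘ₗ blk 2 + scIn 2 ∘ₗ sc 6]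
    (IsFFN.hat_smul (sc 5) (sc 6 + (2 : ℝ) • sc 2 - sc 5) (scIn 3 1))
  refine ⟨θ, by omega, fun n N S c v e f w hS hN hNn => ?_⟩
  refine hθ n _ (fun j => (![v j, e j, f j, f (n - N)],
    ![c, if j = n - N then 1 else 0, S * w (n - N), 0, 1, S, S * w j, S * (j + 1)])) _
    (fun j _ => ?_) (fun j _ => ?_)
  · have hlt : n - N < n := by omega
    have relu_ite : ∀ i, relu (if i = n - N then 1 else 0) = if i = n - N then 1 else 0 := by
      intro i
      split_ifs <;> simp [relu]
    simp only [Fin.sum_univ_one, Matrix.cons_val_zero, prodForm_apply, sc_apply,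
      LinearMap.add_apply, LinearMap.comp_apply, blk_apply, Matrix.cons_val, one_mul, relu_ite,
      ite_smul, one_smul, zero_smul, Finset.sum_ite_eq', Finset.mem_range, hlt, if_true]
    ext a b
    · fin_cases a <;> simp
    · fin_cases a <;> simp
  · have key : hat S (S * w j + 2 * (S * w (n - N)) - S)
        = if w j + 2 * w (n - N) - 1 = 0 then S else 0 := by
      rw [← hat_int_mul hS le_rfl]
      push_cast
      ring_nf
    ext a b
    · fin_cases a <;> simp
    · fin_cases a <;> simp
      exact key.symm

/-- Each token whose layer index does not match erases its embedding. -/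
theorem exists_gating_layer (d : ℕ) : ∃ θ : TFLayer (4 * d + 8), θ.M ≤ 8 ∧
    ∀ (n : ℕ) (S c o : ℝ) (v e f : ℕ → Fin d → ℝ) (X : Fin d → ℝ) (ind x y : ℕ → ℝ)
      (p : ℕ → Prop) [DecidablePred p], (∀ j < n, ∀ k, |v j k| ≤ S) →
      layerMap relu θ ((List.range n).map fun j => tokEquiv d
          (![v j, e j, f j, X], ![c, ind j, o, if p j then S else 0, 1, S, x j, y j]))
        = (List.range n).map fun j => tokEquiv d
          (![if p j then v j else 0, e j, 0, X],
            ![c, ind j, o, if p j then S else 0, 1, S, x j, y j]) := by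
  let a : Tok d →ₗ[ℝ] (Fin d → ℝ) := LinearMap.pi fun _ => sc 3 - sc 5
  obtain ⟨θ, hM, hθ⟩ := exists_layer (tokEquiv d) 0 ![] ![]
    (((IsFFN.relu_pi (blk 0 + a) (blkIn 0)).add (IsFFN.relu_pi (-blk 0 + a) (-blkIn 0))).add
      (IsFFN.linear (-(blkIn 0 ∘ₗ blk 0) - blkIn 2 ∘ₗ blk 2)))
  refine ⟨θ, by omega, fun n S c o v e f X ind x y p _ hv => ?_⟩
  refine hθ n _ (fun j => (![v j, e j, f j, X],
    ![c, ind j, o, if p j then S else 0, 1, S, x j, y j])) _ (fun j _ => by simp)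
    (fun j hj => ?_)
  ext b k
  · have key := gate (hv j hj k) (p j)
    fin_cases b <;> simp [a]
    rw [apply_ite (fun u : Fin d → ℝ => u k), Pi.zero_apply, ← key]
    ring_nf
  · fin_cases b <;> simp

/-- Each token applies the matrix formed by the ungated tokens and their right neighbours to the
fetched features, and replaces itself by the resulting next token. -/
theorem exists_applying_layer (d : ℕ) : ∃ θ : TFLayer (4 * d + 8), θ.M ≤ 8 ∧
    ∀ (n : ℕ) (S c o : ℝ) (v e : ℕ → Fin d → ℝ) (X : Fin d → ℝ) (ind m x : ℕ → ℝ),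
      layerMap relu θ ((List.range n).map fun j => tokEquiv d
          (![v j, e j, 0, X], ![c, ind j, o, m j, 1, S, x j, S * (j + 1)]))
        = (List.range n).map fun j : ℕ => tokEquiv d
          (![∑ i ∈ Finset.range n, (X ⬝ᵥ e i) • v i, 0, 0, 0],
            ![0, 0, 0, 0, 1, S, o - S, S * (j + 1) + S]) := by
  obtain ⟨θ, hM, hθ⟩ := exists_layer (tokEquiv d) 2
    ![dotForm 3 1, -dotForm 3 1] ![blkIn 2 ∘ₗ blk 0, -(blkIn 2 ∘ₗ blk 0)]
    (IsFFN.linear (-LinearMap.id + blkIn 0 ∘ₗ blk 2 + scIn 4 ∘ₗ sc 4 + scIn 5 ∘ₗ sc 5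
      + scIn 6 ∘ₗ (sc 2 - sc 5) + scIn 7 ∘ₗ (sc 7 + sc 5)))
  refine ⟨θ, by omega, fun n S c o v e X ind m x => ?_⟩
  refine hθ n _ (fun j => (![v j, e j, ∑ i ∈ Finset.range n, (X ⬝ᵥ e i) • v i, X],
    ![c, ind j, o, m j, 1, S, x j, S * (j + 1)])) _ (fun j _ => ?_) (fun j _ => ?_)
  · rw [Fin.sum_univ_two, ← Finset.sum_add_distrib,
      Finset.sum_congr rfl (g := fun i => blkIn 2 ((X ⬝ᵥ e i) • v i)), ← map_sum]
    · generalize ∑ i ∈ Finset.range n, (X ⬝ᵥ e i) • v i = y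
      ext a b
      · fin_cases a <;> simp
      · fin_cases a <;> simp
    · intro i _
      simp
      rw [← sub_eq_add_neg, ← sub_smul, relu_sub_relu_neg]
  · generalize ∑ i ∈ Finset.range n, (X ⬝ᵥ e i) • v i = y
    ext a b
    · fin_cases a <;> simp [-Matrix.cons_add]
    · fin_cases a <;> simp [-Matrix.cons_add]

theorem exists_identity_layer (d : ℕ) : ∃ θ : TFLayer (4 * d + 8), θ.M ≤ 8 ∧
    ∀ (n : ℕ) (t : ℕ → Tok d), layerMap relu θ ((List.range n).map fun j => tokEquiv d (t j))
      = (List.range n).map fun j => tokEquiv d (t j) := by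
  obtain ⟨θ, hM, hθ⟩ := exists_layer (tokEquiv d) 0 ![] ![] IsFFN.zero
  exact ⟨θ, by omega, fun n t => hθ n t t t (fun j _ => by simp) (fun j _ => by simp)⟩

/-- The next token predicted by a fixed transformer on a sequence containing `N` tokens with layer
index `0`: the source token is the one `N` positions before the prediction. -/
theorem exists_transformer (d : ℕ) : ∃ Θ : List (TFLayer (4 * d + 8)),
    Θ.length = 7 ∧ (∀ θ ∈ Θ, θ.M ≤ 8) ∧
    ∀ (n N : ℕ) (S : ℝ) (v : ℕ → Fin d → ℝ) (w : ℕ → ℤ), 1 ≤ S → 0 < N → N ≤ n →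
      ((Finset.range n).filter fun i => w i = 0).card = N → (∀ j < n, ∀ k, |v j k| ≤ S) →
      (tfForward Θ ((List.range n).map fun j => promptToken d (v j) (w j) (j + 1) S)).getLastD
          (fun _ => 0)
        = promptToken d (∑ i ∈ Finset.range n,
            ((fun k => relu (v (n - N) k)) ⬝ᵥ (if i + 1 < n then v (i + 1) else 0)) •
              if w i + 2 * w (n - N) - 1 = 0 then v i else 0) (w (n - N) - 1) (n + 1) S := by
  obtain ⟨θ₁, hM₁, h₁⟩ := exists_locating_layer d
  obtain ⟨θ₂, hM₂, h₂⟩ := exists_matching_layer d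
  obtain ⟨θ₃, hM₃, h₃⟩ := exists_gating_layer d
  obtain ⟨θ₄, hM₄, h₄⟩ := exists_applying_layer d
  obtain ⟨θ₅, hM₅, h₅⟩ := exists_identity_layer d
  refine ⟨[θ₁, θ₂, θ₃, θ₄, θ₅, θ₅, θ₅], rfl, by simp [*], fun n N S v w hS hN hNn hw hv => ?_⟩
  obtain ⟨n, rfl⟩ : ∃ n', n = n' + 1 := ⟨n - 1, by omega⟩
  simp only [promptToken_eq_tokEquiv, tfForward, List.foldl_cons, List.foldl_nil, Nat.cast_add,
    Nat.cast_one]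
  have e₁ := h₁ (n + 1) N S v w hS hNn hw
  rw [Nat.cast_add, Nat.cast_one] at e₁
  rw [e₁, h₂ _ _ _ _ _ _ _ _ (by linarith) hN hNn, h₃ _ _ _ _ _ _ _ _ _ _ _ _ hv, h₄, h₅, h₅, h₅,
    List.range_succ, List.map_append, List.map_singleton, List.getLastD_concat]
  push_cast
  ring_nf

theorem abs_le_of_mem_eball {d : ℕ} {B : ℝ} {u : Fin d → ℝ} (hu : u ∈ eball d B) (k : Fin d) :
    |u k| ≤ B := by
  refine le_trans ?_ hu
  rw [← Real.sqrt_sq_eq_abs]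
  exact Real.sqrt_le_sqrt
    (Finset.single_le_sum (f := fun k => u k ^ 2) (fun _ _ => sq_nonneg _) (Finset.mem_univ k))

theorem norm_mulVec_le {d : ℕ} (W : Matrix (Fin d) (Fin d) ℝ) (x : Fin d → ℝ) :
    ‖WithLp.toLp 2 (W *ᵥ x)‖ ≤ opNorm W * ‖WithLp.toLp 2 x‖ :=
  (LinearMap.toContinuousLinearMap (Matrix.toEuclideanLin W)).le_opNorm (WithLp.toLp 2 x)

theorem norm_relu_le {d : ℕ} (x : Fin d → ℝ) :
    ‖WithLp.toLp 2 fun k => relu (x k)‖ ≤ ‖WithLp.toLp 2 x‖ := by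
  rw [EuclideanSpace.norm_eq, EuclideanSpace.norm_eq]
  gcongr with k
  simp only [relu, Real.norm_eq_abs]
  rw [abs_of_nonneg (le_max_right _ _)]
  exact max_le (le_abs_self _) (abs_nonneg _)

theorem norm_vnetOut_le {d L : ℕ} {W : ℕ → Matrix (Fin d) (Fin d) ℝ} {C : ℝ} (hC : 0 ≤ C)
    (hW : ∀ ℓ, 1 ≤ ℓ → ℓ ≤ L → opNorm (W ℓ) ≤ C) (z : Fin d → ℝ) {q : ℕ} (hq : q ≤ L) :
    ‖WithLp.toLp 2 (vnetOut d relu W z q)‖ ≤ C ^ q * ‖WithLp.toLp 2 z‖ := by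
  induction q with
  | zero => simp [vnetOut]
  | succ q ih =>
    rw [vnetOut, pow_succ', mul_assoc]
    refine (norm_mulVec_le _ _).trans (mul_le_mul (hW _ (by omega) hq) ?_ (norm_nonneg _) hC)
    refine le_trans ?_ (ih (by omega))
    split_ifs
    · exact le_rfl
    · exact norm_relu_le _

theorem vnetOut_succ_of_nonneg {d : ℕ} (W : ℕ → Matrix (Fin d) (Fin d) ℝ) {z : Fin d → ℝ}
    (hz : ∀ k, 0 ≤ z k) (q : ℕ) :
    vnetOut d relu W z (q + 1) = W (q + 1) *ᵥ fun k => relu (vnetOut d relu W z q k) := by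
  rw [vnetOut]
  congr 1
  ext k
  split_ifs with h
  · subst h
    exact (max_eq_left (hz k)).symm
  · rfl

theorem abs_vnetOut_le {d L : ℕ} {r : ℕ → ℕ} {U : Set (Fin d → ℝ)} {B S : ℝ} (hB : 1 ≤ B)
    {W : ℕ → Matrix (Fin d) (Fin d) ℝ} (hW : ∀ ℓ, 1 ≤ ℓ → ℓ ≤ L → W ℓ ∈ coarseW d (r ℓ) U B)
    (hS : (d : ℝ) * (((Finset.Icc 1 L).sup r : ℕ) : ℝ) * B ^ (4 * L) ≤ S) (hS1 : 1 ≤ S)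
    {z : Fin d → ℝ} (hz : ∀ k, z k ∈ Set.Icc (0 : ℝ) 1) {q : ℕ} (hq : q ≤ L) (k : Fin d) :
    |vnetOut d relu W z q k| ≤ S := by
  rcases Nat.eq_zero_or_pos q with rfl | hq0
  · rw [vnetOut, abs_of_nonneg (hz k).1]
    exact (hz k).2.trans hS1
  obtain hr | hr := Nat.eq_zero_or_pos ((Finset.Icc 1 L).sup r)
  · obtain ⟨q, rfl⟩ : ∃ q', q = q' + 1 := ⟨q - 1, by omega⟩
    have hrq : r (q + 1) = 0 :=
      Nat.le_zero.1 (hr ▸ Finset.le_sup (f := r) (Finset.mem_Icc.2 ⟨hq0, hq⟩))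
    obtain ⟨⟨ut, uu, -, -, h⟩, -⟩ := hW (q + 1) hq0 hq
    have : IsEmpty (Fin (r (q + 1))) := by
      rw [hrq]
      infer_instance
    rw [Finset.univ_eq_empty, Finset.sum_empty] at h
    rw [vnetOut, h, Matrix.zero_mulVec]
    simpa using zero_le_one.trans hS1
  · have hd : (1 : ℝ) ≤ d := by exact_mod_cast k.pos
    have hr' : (1 : ℝ) ≤ (((Finset.Icc 1 L).sup r : ℕ) : ℝ) := by exact_mod_cast hr
    have hz' : ‖WithLp.toLp 2 z‖ ≤ d := by
      rw [EuclideanSpace.norm_eq, Real.sqrt_le_left (by positivity)]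
      calc ∑ i, ‖WithLp.toLp 2 z i‖ ^ 2 ≤ ∑ _i : Fin d, (1 : ℝ) := by
            gcongr with i
            rw [Real.norm_eq_abs, abs_of_nonneg (hz i).1]
            exact pow_le_one₀ (hz i).1 (hz i).2
        _ ≤ (d : ℝ) ^ 2 := by
            simp only [Finset.sum_const, Finset.card_univ, Fintype.card_fin, nsmul_eq_mul]
            nlinarith
    calc |vnetOut d relu W z q k| ≤ ‖WithLp.toLp 2 (vnetOut d relu W z q)‖ :=
          PiLp.norm_apply_le (WithLp.toLp 2 (vnetOut d relu W z q)) k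
      _ ≤ (B ^ 2) ^ q * ‖WithLp.toLp 2 z‖ :=
          norm_vnetOut_le (by positivity) (fun ℓ h1 h2 => (hW ℓ h1 h2).2) z hq
      _ ≤ B ^ (4 * L) * d := by
          rw [← pow_mul]
          gcongr
          norm_num
      _ ≤ d * (((Finset.Icc 1 L).sup r : ℕ) : ℝ) * B ^ (4 * L) := by
          have : 0 ≤ B ^ (4 * L) * d := by positivity
          nlinarith
      _ ≤ S := hS

theorem sum_range_two_mul {A : Type} [AddCommMonoid A] (f : ℕ → A) (R : ℕ) :
    ∑ i ∈ Finset.range (2 * R), f i = ∑ p : Fin R, (f (2 * p) + f (2 * p + 1)) := by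
  rw [Fin.sum_univ_eq_sum_range fun p => f (2 * p) + f (2 * p + 1)]
  induction R with
  | zero => simp
  | succ R ih =>
    rw [mul_add, mul_one, Finset.sum_range_succ, Finset.sum_range_succ, ih, Finset.sum_range_succ,
      add_assoc]

/-- The rank-one summands of all weight matrices, listed with the layers they belong to. -/
theorem exists_rank_one_list {d L : ℕ} {r : ℕ → ℕ} {U : Set (Fin d → ℝ)} {B : ℝ}
    {W : ℕ → Matrix (Fin d) (Fin d) ℝ} (hW : ∀ ℓ, 1 ≤ ℓ → ℓ ≤ L → W ℓ ∈ coarseW d (r ℓ) U B) :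
    ∃ (a b : Fin (∑ ℓ ∈ Finset.Icc 1 L, r ℓ) → Fin d → ℝ)
      (lab : Fin (∑ ℓ ∈ Finset.Icc 1 L, r ℓ) → ℕ),
      (∀ p, a p ∈ U ∧ b p ∈ U ∧ 1 ≤ lab p ∧ lab p ≤ L) ∧
      ∀ q < L, W (q + 1) = ∑ p, if lab p = q + 1 then vecMulVec (a p) (b p) else 0 := by
  choose ut uu hut huu hsum using fun i : Fin L => (hW (i + 1) (by omega) (by omega)).1
  have hcard : Fintype.card (Σ i : Fin L, Fin (r (i + 1))) = ∑ ℓ ∈ Finset.Icc 1 L, r ℓ := by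
    rw [Fintype.card_sigma]
    simp only [Fintype.card_fin]
    rw [Fin.sum_univ_eq_sum_range fun i => r (i + 1), Finset.range_eq_Ico,
      Finset.sum_Ico_add' r 0 L 1]
    rfl
  let e := (Fintype.equivFinOfCardEq hcard).symm
  refine ⟨fun p => ut (e p).1 (e p).2, fun p => uu (e p).1 (e p).2, fun p => (e p).1 + 1,
    fun p => ⟨hut _ _, huu _ _, Nat.le_add_left _ _, (e p).1.2⟩, fun q hq => ?_⟩
  rw [Equiv.sum_comp e fun x => if (x.1 : ℕ) + 1 = q + 1 then vecMulVec (ut x.1 x.2) (uu x.1 x.2)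
    else 0, Fintype.sum_sigma, Finset.sum_eq_single ⟨q, hq⟩]
  · simpa using hsum ⟨q, hq⟩
  · intro i _ hi
    have : (i : ℕ) ≠ q := fun h => hi (Fin.ext h)
    simp [this]
  · simp

/-- The prompt listing the rank-one summands of all weight matrices makes the transformer
apply these matrices. -/
theorem exists_prompt {d L : ℕ} {r : ℕ → ℕ} {U : Set (Fin d → ℝ)} {B : ℝ}
    {W : ℕ → Matrix (Fin d) (Fin d) ℝ} (hW : ∀ ℓ, 1 ≤ ℓ → ℓ ≤ L → W ℓ ∈ coarseW d (r ℓ) U B)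
    {T : ℕ} (hT : T = 2 * ∑ ℓ ∈ Finset.Icc 1 L, r ℓ) :
    ∃ (u : Fin T → Fin d → ℝ) (w : Fin T → ℕ), ValidPrompt U T L u w ∧
      ∀ (n : ℕ) (v : ℕ → Fin d → ℝ) (x : ℕ → ℤ), T ≤ n → (∀ j : Fin T, v j = u j) →
        (∀ j : Fin T, x j = w j) → (∀ j, T ≤ j → x j ≤ 0) → ∀ q < L, ∀ y : Fin d → ℝ,
        (∑ i ∈ Finset.range n, (y ⬝ᵥ (if i + 1 < n then v (i + 1) else 0)) •
          if x i + 2 * (-(q : ℤ)) - 1 = 0 then v i else 0) = W (q + 1) *ᵥ y := by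
  obtain ⟨a, b, lab, hmem, hsum⟩ := exists_rank_one_list hW
  generalize hR : ∑ ℓ ∈ Finset.Icc 1 L, r ℓ = R at *
  subst hT
  refine ⟨fun j => if (j : ℕ) % 2 = 0 then a ⟨j / 2, by omega⟩ else b ⟨j / 2, by omega⟩,
    fun j => if (j : ℕ) % 2 = 0 then 2 * lab ⟨j / 2, by omega⟩ - 1 else 2 * lab ⟨j / 2, by omega⟩,
    ⟨fun j => ?_, fun j => ?_⟩, fun n v x hn hv hx hx' q hq y => ?_⟩
  · dsimp only
    split_ifs
    exacts [(hmem _).1, (hmem _).2.1]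
  · have := hmem ⟨j / 2, by omega⟩
    dsimp only
    split_ifs <;> omega
  · have hodd : ∀ p : ℕ, (2 * p + 1) % 2 = 1 ∧ (2 * p + 1) / 2 = p := fun p => by omega
    have hva : ∀ p : Fin R, v (2 * p) = a p := fun p => by
      simpa using hv ⟨2 * p, by omega⟩
    have hvb : ∀ p : Fin R, v (2 * p + 1) = b p := fun p => by
      simpa [hodd] using hv ⟨2 * p + 1, by omega⟩
    have hxa : ∀ p : Fin R, x (2 * p) = 2 * lab p - 1 := fun p => by
      have h1 := (hmem p).2.2.1
      have h2 := hx ⟨2 * p, by omega⟩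
      simp at h2
      omega
    have hxb : ∀ p : Fin R, x (2 * p + 1) = 2 * lab p := fun p => by
      simpa [hodd] using hx ⟨2 * p + 1, by omega⟩
    rw [← Finset.sum_subset (Finset.range_subset_range.2 hn), sum_range_two_mul, hsum q hq,
      Matrix.sum_mulVec]
    · refine Finset.sum_congr rfl fun p _ => ?_
      rw [if_pos (by omega), hva, hvb, hxa, hxb, if_neg (c := 2 * (lab p : ℤ) + _ - 1 = 0)
        (by omega), smul_zero, add_zero]
      by_cases h : lab p = q + 1
      · rw [if_pos h, if_pos (by omega), vecMulVec_mulVec, dotProduct_comm]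
        simp
      · rw [if_neg h, if_neg (by omega), smul_zero, Matrix.zero_mulVec]
    · intro i _ hi
      have := hx' i (by simpa using hi)
      rw [if_neg (c := x i + _ - 1 = 0) (by omega), smul_zero]

/-- A transformer that predicts the next virtual layer generates all virtual layers. -/
theorem genTokens_eq {d T L N : ℕ} {S : ℝ} {u : Fin T → Fin d → ℝ} {w : Fin T → ℕ}
    {z : Fin N → Fin d → ℝ} {forward : List (Fin (4 * d + 8) → ℝ) → List (Fin (4 * d + 8) → ℝ)}
    (v : ℕ → Fin d → ℝ) (x : ℕ → ℤ)
    (hv : ∀ j : Fin T, v j = u j) (hx : ∀ j : Fin T, x j = w j)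
    (hv' : ∀ i : Fin N, v (T + i) = z i) (hx' : ∀ i : Fin N, x (T + i) = 0)
    (hf : ∀ k < N * L, (forward ((List.range (T + N + k)).map fun j =>
        promptToken d (v j) (x j) (j + 1) S)).getLastD (fun _ => 0)
      = promptToken d (v (T + N + k)) (x (T + N + k)) (T + N + k + 1) S)
    {k : ℕ} (hk : k ≤ N * L) :
    genTokens forward (initialInput d T N u w S z) k
      = (List.range (T + N + k)).map fun j => promptToken d (v j) (x j) (j + 1) S := by
  induction k with
  | zero =>
    refine List.ext_getElem (by simp [genTokens, initialInput]) fun j h₁ h₂ => ?_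
    simp only [genTokens, initialInput, List.getElem_append, List.length_map, List.length_finRange,
      List.getElem_map, List.getElem_finRange, List.getElem_range]
    have hj : j < T + N := by simpa using h₂
    split_ifs with h
    · simp [hv ⟨j, h⟩, hx ⟨j, h⟩]
    · obtain ⟨i, rfl⟩ := Nat.exists_eq_add_of_le (not_lt.1 h)
      simp [hv' ⟨i, by omega⟩, hx' ⟨i, by omega⟩]
  | succ k ih =>
    rw [genTokens, ih (by omega), hf k (by omega), ← add_assoc, List.range_succ, List.map_append,
      List.map_singleton]

end PromptTF

/-- A fixed `7`-layer transformer with at most `8` heads per layer that,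
given a suitable prompt, exactly emulates any coarse neural network
`g(z) = W_L σ(W_{L−1} σ(⋯ σ(W_1 z)⋯))` with `W_ℓ ∈ W(r_ℓ, d, U, B)`, on any data tokens. -/
theorem statement_4 (d : ℕ) (hd : 0 < d) :
    ∃ Θ : List (TFLayer (4 * d + 8)),
      Θ.length = 7 ∧ (∀ θ ∈ Θ, θ.M ≤ 8) ∧
      ∀ B : ℝ, 1 ≤ B → ∀ L : ℕ, 0 < L →
      ∀ (r : ℕ → ℕ) (U : Set (Fin d → ℝ)), U ⊆ eball d B →
      ∀ W : ℕ → Matrix (Fin d) (Fin d) ℝ,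
        (∀ ℓ, 1 ≤ ℓ → ℓ ≤ L → W ℓ ∈ coarseW d (r ℓ) U B) →
      ∀ S : ℝ,
        max ((d : ℝ) * (((Finset.Icc 1 L).sup r : ℕ) : ℝ) * B ^ (4 * L)) (2 * (L : ℝ)) ≤ S →
      ∀ T : ℕ, T = 2 * ∑ ℓ ∈ Finset.Icc 1 L, r ℓ →
        ∃ (u : Fin T → Fin d → ℝ) (w : Fin T → ℕ),
          ValidPrompt U T L u w ∧
          ∀ N : ℕ, 0 < N → ∀ z : Fin N → Fin d → ℝ,
            (∀ i k, z i k ∈ Set.Icc (0 : ℝ) 1) →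
          ∀ (i : Fin N) (ℓ : ℕ), 1 ≤ ℓ → ℓ ≤ L →
            tokenAt (tfForward Θ) (initialInput d T N u w S z) (T + N * ℓ + (i : ℕ) + 1)
              = promptToken d (vnetOut d relu W (z i) ℓ) (-(ℓ : ℤ))
                  (T + N * ℓ + (i : ℕ) + 1) S := by
  obtain ⟨Θ, hlen, hM, hΘ⟩ := exists_transformer d
  refine ⟨Θ, hlen, hM, fun B hB L hL r U hU W hW S hS T hT => ?_⟩
  obtain ⟨hS, hS'⟩ := max_le_iff.1 hS
  have hS1 : 1 ≤ S := by
    have : (1 : ℝ) ≤ L := by exact_mod_cast hL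
    linarith
  obtain ⟨u, w, hvalid, hprompt⟩ := exists_prompt hW hT
  refine ⟨u, w, hvalid, fun N hN z hz i ℓ hℓ hℓL => ?_⟩
  let v : ℕ → Fin d → ℝ := fun j => if h : j < T then u ⟨j, h⟩ else
    vnetOut d relu W (z ⟨(j - T) % N, Nat.mod_lt _ hN⟩) ((j - T) / N)
  let x : ℕ → ℤ := fun j => if h : j < T then w ⟨j, h⟩ else -(((j - T) / N : ℕ) : ℤ)
  have hv : ∀ j : Fin T, v j = u j := fun j => by simp [v]
  have hx : ∀ j : Fin T, x j = w j := fun j => by simp [x]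
  have hv' : ∀ (q : ℕ) (i : Fin N), v (T + (N * q + i)) = vnetOut d relu W (z i) q := by
    intro q i
    simp [v, Nat.mul_add_div hN, Nat.div_eq_of_lt i.2, Nat.mod_eq_of_lt i.2]
  have hx' : ∀ (q : ℕ) (i : Fin N), x (T + (N * q + i)) = -q := by
    intro q i
    simp only [x, Nat.not_lt_of_le (Nat.le_add_right T _), dif_neg, not_false_eq_true,
      Nat.add_sub_cancel_left, Nat.mul_add_div hN, Nat.div_eq_of_lt i.2, add_zero]
  have hx_nonpos : ∀ j, T ≤ j → x j ≤ 0 := fun j hj => by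
    simp only [x, not_lt.2 hj, dif_neg, not_false_eq_true]
    exact neg_nonpos.2 (Nat.cast_nonneg _)
  have hbound : ∀ j < T + N + N * L, ∀ k, |v j k| ≤ S := by
    intro j hj k
    by_cases h : j < T
    · have hsup : 1 ≤ (Finset.Icc 1 L).sup r := by
        by_contra! hcon
        have : ∀ ℓ ∈ Finset.Icc 1 L, r ℓ = 0 := fun ℓ hℓ => by
          have := Finset.le_sup (f := r) hℓ
          omega
        rw [Finset.sum_eq_zero this] at hT
        omega
      have hd' : (1 : ℝ) ≤ d := by exact_mod_cast hd
      have hsup' : (1 : ℝ) ≤ (((Finset.Icc 1 L).sup r : ℕ) : ℝ) := by exact_mod_cast hsup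
      calc |v j k| = |u ⟨j, h⟩ k| := by rw [← hv]
        _ ≤ B := abs_le_of_mem_eball (hU (hvalid.1 _)) k
        _ ≤ B ^ (4 * L) := le_self_pow₀ hB (by omega)
        _ ≤ d * (((Finset.Icc 1 L).sup r : ℕ) : ℝ) * B ^ (4 * L) :=
          le_mul_of_one_le_left (by positivity) (one_le_mul_of_one_le_of_one_le hd' hsup')
        _ ≤ S := hS
    · simp only [v, h, dif_neg, not_false_eq_true]
      refine abs_vnetOut_le hB hW hS hS1 (hz _) ?_ k
      rw [← Nat.lt_succ_iff, Nat.div_lt_iff_lt_mul hN, Nat.succ_mul, mul_comm L]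
      omega
  have hcard : ∀ k, ((Finset.range (T + N + k)).filter fun j => x j = 0).card = N := by
    intro k
    have : ((Finset.range (T + N + k)).filter fun j => x j = 0) = Finset.Ico T (T + N) := by
      ext j
      simp only [Finset.mem_filter, Finset.mem_range, Finset.mem_Ico]
      by_cases h : j < T
      · have := (hvalid.2 ⟨j, h⟩).1
        have := hx ⟨j, h⟩
        dsimp only at this
        omega
      · simp only [x, h, dif_neg, not_false_eq_true, neg_eq_zero, Nat.cast_eq_zero,
          Nat.div_eq_zero_iff]
        omega
    rw [this, Nat.card_Ico]
    omega
  have hgen := fun k hk => genTokens_eq (forward := tfForward Θ) (L := L) (S := S) (k := k) v x hv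
    hx (fun i => by simpa [vnetOut] using hv' 0 i) (fun i => by simpa using hx' 0 i) (fun k hk => ?_)
    hk
  · obtain ⟨q, rfl⟩ : ∃ q, ℓ = q + 1 := ⟨ℓ - 1, by omega⟩
    have hNq : N * (q + 1) ≤ N * L := Nat.mul_le_mul_left N hℓL
    have hi := i.2
    have hlenH : (initialInput d T N u w S z).length = T + N := by simp [initialInput]
    have hidx : T + N * (q + 1) + i = T + (N * (q + 1) + i) := by omega
    rw [mul_add, mul_one] at hNq
    rw [tokenAt, hlenH, hgen _ (by rw [mul_add]; omega), Nat.add_sub_cancel,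
      List.getD_eq_getElem _ _ (by simp; omega)]
    simp only [List.getElem_map, List.getElem_range]
    rw [hidx, hv', hx']
  · have hk' : T + k < T + N + k := by omega
    obtain ⟨q, i, rfl⟩ : ∃ (q : ℕ) (i : Fin N), k = N * q + i :=
      ⟨k / N, ⟨k % N, Nat.mod_lt _ hN⟩, (Nat.div_add_mod k N).symm⟩
    have hq : q < L := lt_of_mul_lt_mul_left' (a := N) (by omega)
    rw [hΘ _ N S v x hS1 hN (by omega) (hcard _) (fun j hj => hbound j (by omega)),
      show T + N + (N * q + i) - N = T + (N * q + i) by omega, hv', hx',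
      hprompt _ v x (by omega) hv hx hx_nonpos q hq,
      ← vnetOut_succ_of_nonneg W (fun k => (hz i k).1),
      show T + N + (N * q + (i : ℕ)) = T + (N * (q + 1) + i) by ring, hv', hx']
    rw [Nat.cast_succ, neg_add']
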